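/- With E and B the u-electric and u-magnetic parts of a Weyl-type tensor W, the following reconstruction formula holds: W_{αβγδ} = 2(π_{β[γ}E_{δ]α} − u_β u_{[γ}E_{δ]α} − π_{α[γ}E_{δ]β} + u_α u_{[γ}E_{δ]β}) − 2(u_{[γ}B_{δ]μ}ε^μ_{αβ} + u_{[α}B_{β]μ}ε^μ_{γδ}). -/

import Mathlib

/-- Minkowski metric components `diag(1,-1,-1,-1)`, signature (+,-,-,-). -/
def eta : Fin 4 → Fin 4 → ℝ :=
  fun a b => if a = b then (if a = 0 then 1 else -1) else 0

/-- The totally antisymmetric symbol on four indices with `eps4 0 1 2 3 = 1`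
(`ε_{0123} = +1`), via the Vandermonde product formula. -/
noncomputable def eps4 : Fin 4 → Fin 4 → Fin 4 → Fin 4 → ℝ :=
  fun a b c d =>
    (((b.val : ℝ) - a.val) * ((c.val : ℝ) - a.val) * ((d.val : ℝ) - a.val) *
      ((c.val : ℝ) - b.val) * ((d.val : ℝ) - b.val) * ((d.val : ℝ) - c.val)) / 12

/-- Raised components `u^α = g^{αμ} u_μ` of a covector `u`. -/
def uUp (u : Fin 4 → ℝ) (α : Fin 4) : ℝ := ∑ μ, eta α μ * u μ

/-- The projection `π_α{}^β = δ_α^β − u_α u^β` onto the orthogonal complement of `u`. -/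
def projUD (u : Fin 4 → ℝ) (a b : Fin 4) : ℝ :=
  (if a = b then 1 else 0) - u a * uUp u b

/-- The induced spatial volume form `ε_{αβγ} = ε_{μνστ} u^μ π_α^ν π_β^σ π_γ^τ`. -/
noncomputable def eps3 (u : Fin 4 → ℝ) (a b c : Fin 4) : ℝ :=
  ∑ μ, ∑ ν, ∑ σ, ∑ τ,
    eps4 μ ν σ τ * uUp u μ * projUD u a ν * projUD u b σ * projUD u c τ

/-- The dual `W*_{αβγδ} = (1/2) ε_{γδ}{}^{μν} W_{αβμν}`. -/
noncomputable def wdual (W : Fin 4 → Fin 4 → Fin 4 → Fin 4 → ℝ)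
    (a b c d : Fin 4) : ℝ :=
  (1/2) * ∑ μ, ∑ ν,
    (∑ μ', ∑ ν', eta μ μ' * eta ν ν' * eps4 c d μ' ν') * W a b μ ν

/-- The `u`-electric part `E_{αβ} = W_{μνστ} u^μ u^σ π_α^ν π_β^τ`. -/
noncomputable def electric (W : Fin 4 → Fin 4 → Fin 4 → Fin 4 → ℝ)
    (u : Fin 4 → ℝ) (a b : Fin 4) : ℝ :=
  ∑ μ, ∑ ν, ∑ σ, ∑ τ,
    W μ ν σ τ * uUp u μ * uUp u σ * projUD u a ν * projUD u b τ

/-- The `u`-magnetic part `B_{αβ} = W*_{μνστ} u^μ u^σ π_α^ν π_β^τ`. -/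
noncomputable def magnetic (W : Fin 4 → Fin 4 → Fin 4 → Fin 4 → ℝ)
    (u : Fin 4 → ℝ) (a b : Fin 4) : ℝ :=
  electric (wdual W) u a b

/-- The projected metric `π_{αβ} = g_{αβ} − u_α u_β`. -/
def projLL (u : Fin 4 → ℝ) (a b : Fin 4) : ℝ := eta a b - u a * u b

/-- `ε^μ{}_{αβ}`: the spatial volume form with first index raised. -/
noncomputable def eps3U1 (u : Fin 4 → ℝ) (m a b : Fin 4) : ℝ :=
  ∑ m', eta m m' * eps3 u m' a b

/-- A quadruply indexed array antisymmetric in its first and in its second pair of indices. -/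
structure IsBiantisymmetric (W : Fin 4 → Fin 4 → Fin 4 → Fin 4 → ℝ) : Prop where
  swap_left : ∀ a b c d, W b a c d = -W a b c d
  swap_right : ∀ a b c d, W a b d c = -W a b c d

lemma sum_antisymm_eq_zero {A : Fin 4 → Fin 4 → ℝ} (hA : ∀ μ ν, A ν μ = -A μ ν)
    (v : Fin 4 → ℝ) : ∑ ν, (∑ μ, A μ ν * v μ) * v ν = 0 := by
  have h : ∑ ν, ∑ μ, A μ ν * v μ * v ν = -∑ ν, ∑ μ, A μ ν * v μ * v ν := by
    conv_lhs => rw [Finset.sum_comm]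
    simp_rw [← Finset.sum_neg_distrib]
    refine Finset.sum_congr rfl fun μ _ => Finset.sum_congr rfl fun ν _ => ?_
    rw [hA ν μ]
    ring
  simp_rw [Finset.sum_mul]
  linarith

/-- Contracting one index of an antisymmetric array with `u` makes projecting the other one
redundant. -/
lemma sum_antisymm_mul_projUD {A : Fin 4 → Fin 4 → ℝ} (hA : ∀ μ ν, A ν μ = -A μ ν)
    (u : Fin 4 → ℝ) (a : Fin 4) :
    ∑ ν, (∑ μ, A μ ν * uUp u μ) * projUD u a ν = ∑ μ, A μ a * uUp u μ := by
  have h : ∀ x ν, x * projUD u a ν = (if a = ν then x else 0) - u a * (x * uUp u ν) := by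
    intro x ν
    unfold projUD
    split_ifs <;> ring
  simp_rw [h, Finset.sum_sub_distrib, ← Finset.mul_sum, sum_antisymm_eq_zero hA]
  simp

lemma electric_eq {W : Fin 4 → Fin 4 → Fin 4 → Fin 4 → ℝ} (hW : IsBiantisymmetric W)
    (u : Fin 4 → ℝ) (a b : Fin 4) :
    electric W u a b = ∑ μ, (∑ σ, W μ a σ b * uUp u σ) * uUp u μ := by
  calc electric W u a b
      = ∑ ν, (∑ μ, (∑ τ, (∑ σ, W μ ν σ τ * uUp u σ) * projUD u b τ) * uUp u μ) *
          projUD u a ν := by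
        rw [electric, Finset.sum_comm]
        simp_rw [Finset.sum_mul]
        refine Finset.sum_congr rfl fun ν _ => Finset.sum_congr rfl fun μ _ => ?_
        rw [Finset.sum_comm]
        refine Finset.sum_congr rfl fun τ _ => Finset.sum_congr rfl fun σ _ => ?_
        ring
    _ = ∑ ν, (∑ μ, (∑ σ, W μ ν σ b * uUp u σ) * uUp u μ) * projUD u a ν := by
        simp_rw [fun μ ν => sum_antisymm_mul_projUD (hW.swap_right μ ν) u b]
    _ = ∑ μ, (∑ σ, W μ a σ b * uUp u σ) * uUp u μ :=
        sum_antisymm_mul_projUD (A := fun μ ν => ∑ σ, W μ ν σ b * uUp u σ)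
          (fun μ ν => by simp only [hW.swap_left μ ν, neg_mul, Finset.sum_neg_distrib]) u a

lemma eps3_eq (u : Fin 4 → ℝ) (a b c : Fin 4) :
    eps3 u a b c = ∑ μ, eps4 μ a b c * uUp u μ := by
  have h₁ : ∀ ν σ, ∑ τ, (∑ μ, eps4 μ ν σ τ * uUp u μ) * projUD u c τ =
      ∑ μ, eps4 μ ν σ c * uUp u μ := fun ν σ =>
    sum_antisymm_mul_projUD (A := fun μ τ => eps4 μ ν σ τ) (fun _ _ => by unfold eps4; ring) u c
  have h₂ : ∀ ν, ∑ σ, (∑ μ, eps4 μ ν σ c * uUp u μ) * projUD u b σ =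
      ∑ μ, eps4 μ ν b c * uUp u μ := fun ν =>
    sum_antisymm_mul_projUD (A := fun μ σ => eps4 μ ν σ c) (fun _ _ => by unfold eps4; ring) u b
  have h₃ : ∑ ν, (∑ μ, eps4 μ ν b c * uUp u μ) * projUD u a ν =
      ∑ μ, eps4 μ a b c * uUp u μ :=
    sum_antisymm_mul_projUD (A := fun μ ν => eps4 μ ν b c) (fun _ _ => by unfold eps4; ring) u a
  rw [← h₃]
  simp_rw [← h₂, ← h₁]
  rw [eps3, Finset.sum_comm]
  refine Finset.sum_congr rfl fun ν _ => ?_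
  rw [Finset.sum_comm, Finset.sum_mul]
  refine Finset.sum_congr rfl fun σ _ => ?_
  rw [Finset.sum_comm, Finset.sum_mul, Finset.sum_mul]
  refine Finset.sum_congr rfl fun τ _ => ?_
  simp_rw [Finset.sum_mul]
  refine Finset.sum_congr rfl fun μ _ => ?_
  ring

lemma isBiantisymmetric_wdual {W : Fin 4 → Fin 4 → Fin 4 → Fin 4 → ℝ}
    (hW : IsBiantisymmetric W) : IsBiantisymmetric (wdual W) where
  swap_left a b c d := by
    simp only [wdual, hW.swap_left a b, mul_neg, Finset.sum_neg_distrib]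
  swap_right a b c d := by
    have h : ∀ μ ν, eps4 d c μ ν = -eps4 c d μ ν := fun _ _ => by unfold eps4; ring
    simp only [wdual, h, mul_neg, neg_mul, Finset.sum_neg_distrib]

/-- An array antisymmetric in both pairs vanishes if its ordered components do. -/
lemma IsBiantisymmetric.eq_zero {W : Fin 4 → Fin 4 → Fin 4 → Fin 4 → ℝ}
    (hW : IsBiantisymmetric W) (h : ∀ a b, a < b → ∀ c d, c < d → W a b c d = 0)
    (a b c d : Fin 4) : W a b c d = 0 := by
  have hr : ∀ a b c d, a < b → W a b c d = 0 := by
    intro a b c d hab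
    rcases lt_trichotomy c d with hcd | rfl | hcd
    · exact h a b hab c d hcd
    · linarith [hW.swap_right a b c c]
    · rw [hW.swap_right, h a b hab d c hcd, neg_zero]
  rcases lt_trichotomy a b with hab | rfl | hab
  · exact hr a b c d hab
  · linarith [hW.swap_left a a c d]
  · rw [hW.swap_left, hr b a c d hab, neg_zero]

lemma eps3U1_swap (u : Fin 4 → ℝ) (m a b : Fin 4) : eps3U1 u m b a = -eps3U1 u m a b := by
  have h : ∀ μ ν, eps4 μ ν b a = -eps4 μ ν a b := fun _ _ => by unfold eps4; ring
  simp only [eps3U1, eps3_eq, h, neg_mul, mul_neg, Finset.sum_neg_distrib]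

lemma forall_fin_four {P : Fin 4 → Prop} (h0 : P 0) (h1 : P 1) (h2 : P 2) (h3 : P 3) (m : Fin 4) :
    P m := by
  fin_cases m <;> assumption

lemma forall_lt_fin_four {P : Fin 4 → Fin 4 → Prop} (h01 : P 0 1) (h02 : P 0 2) (h03 : P 0 3)
    (h12 : P 1 2) (h13 : P 1 3) (h23 : P 2 3) : ∀ a b, a < b → P a b := by
  intro a b hab
  fin_cases a <;> fin_cases b <;> first | assumption | exact absurd hab (by decide)

lemma electric_apply {W : Fin 4 → Fin 4 → Fin 4 → Fin 4 → ℝ} (hW : IsBiantisymmetric W)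
    (u : Fin 4 → ℝ) (a b : Fin 4) :
    electric W u a b =
      (W 0 a 0 b * u 0 - W 0 a 1 b * u 1 - W 0 a 2 b * u 2 - W 0 a 3 b * u 3) * u 0
      - (W 1 a 0 b * u 0 - W 1 a 1 b * u 1 - W 1 a 2 b * u 2 - W 1 a 3 b * u 3) * u 1
      - (W 2 a 0 b * u 0 - W 2 a 1 b * u 1 - W 2 a 2 b * u 2 - W 2 a 3 b * u 3) * u 2
      - (W 3 a 0 b * u 0 - W 3 a 1 b * u 1 - W 3 a 2 b * u 2 - W 3 a 3 b * u 3) * u 3 := by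
  simp [electric_eq hW, Fin.sum_univ_four, uUp, eta]
  ring

lemma wdual_apply {W : Fin 4 → Fin 4 → Fin 4 → Fin 4 → ℝ} (hW : IsBiantisymmetric W)
    (a b : Fin 4) :
    wdual W a b 0 1 = W a b 2 3 ∧ wdual W a b 0 2 = -W a b 1 3 ∧ wdual W a b 0 3 = W a b 1 2 ∧
      wdual W a b 1 2 = -W a b 0 3 ∧ wdual W a b 1 3 = W a b 0 2 ∧
      wdual W a b 2 3 = -W a b 0 1 := by
  refine ⟨?_, ?_, ?_, ?_, ?_, ?_⟩ <;>
    simp [wdual, Fin.sum_univ_four, eta, eps4, hW.swap_right a b 0 1, hW.swap_right a b 0 2,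
      hW.swap_right a b 0 3, hW.swap_right a b 1 2, hW.swap_right a b 1 3,
      hW.swap_right a b 2 3] <;> ring

lemma eps3U1_apply (u : Fin 4 → ℝ) :
    (∀ m, eps3U1 u m 0 1 = ![0, 0, -u 3, u 2] m) ∧
    (∀ m, eps3U1 u m 0 2 = ![0, u 3, 0, -u 1] m) ∧
    (∀ m, eps3U1 u m 0 3 = ![0, -u 2, u 1, 0] m) ∧
    (∀ m, eps3U1 u m 1 2 = ![u 3, 0, 0, -u 0] m) ∧
    (∀ m, eps3U1 u m 1 3 = ![-u 2, 0, u 0, 0] m) ∧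
    (∀ m, eps3U1 u m 2 3 = ![u 1, -u 0, 0, 0] m) := by
  refine ⟨?_, ?_, ?_, ?_, ?_, ?_⟩ <;> refine forall_fin_four ?_ ?_ ?_ ?_ <;>
    simp [eps3U1, eps3_eq, Fin.sum_univ_four, eta, eps4, uUp] <;> norm_num

set_option maxHeartbeats 4000000 in
/-- The reconstruction formula for a covector `u` of arbitrary norm, made homogeneous of degree
four in `u`. -/
lemma weyl_reconstruction_homogeneous
    {W : Fin 4 → Fin 4 → Fin 4 → Fin 4 → ℝ} (hW : IsBiantisymmetric W)
    (hpair : ∀ a b c d, W c d a b = W a b c d)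
    (hbianchi : ∀ a b c d, W a b c d + W a c d b + W a d b c = 0)
    (htrace : ∀ b d, (∑ a, ∑ c, eta a c * W a b c d) = 0)
    (u : Fin 4 → ℝ) (a b c d : Fin 4) :
    (∑ α, ∑ β, eta α β * u α * u β) ^ 2 * W a b c d
      - (∑ α, ∑ β, eta α β * u α * u β) *
        (eta b c * electric W u d a - eta b d * electric W u c a
          - eta a c * electric W u d b + eta a d * electric W u c b)
      + 2 * (u b * u c * electric W u d a - u b * u d * electric W u c a
          - u a * u c * electric W u d b + u a * u d * electric W u c b)
      + (u c * (∑ m, magnetic W u d m * eps3U1 u m a b)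
          - u d * (∑ m, magnetic W u c m * eps3U1 u m a b)
          + u a * (∑ m, magnetic W u b m * eps3U1 u m c d)
          - u b * (∑ m, magnetic W u a m * eps3U1 u m c d)) = 0 := by
  revert a b c d
  apply IsBiantisymmetric.eq_zero
  · constructor <;> intro a b c d
    · simp only [hW.swap_left a b, eps3U1_swap u _ a b, mul_neg, Finset.sum_neg_distrib]
      ring
    · simp only [hW.swap_right a b c d, eps3U1_swap u _ c d, mul_neg, Finset.sum_neg_distrib]
      ring
  have hWd := isBiantisymmetric_wdual hW
  have hl : ∀ a c d, W a a c d = 0 := fun a c d => by linarith [hW.swap_left a a c d]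
  have hr : ∀ a b c, W a b c c = 0 := fun a b c => by linarith [hW.swap_right a b c c]
  have hr' : ∀ a b c, wdual W a b c c = 0 := fun a b c => by linarith [hWd.swap_right a b c c]
  have l10 := hW.swap_left 0 1
  have l20 := hW.swap_left 0 2
  have l30 := hW.swap_left 0 3
  have l21 := hW.swap_left 1 2
  have l31 := hW.swap_left 1 3
  have l32 := hW.swap_left 2 3
  have r10 := fun a b => hW.swap_right a b 0 1
  have r20 := fun a b => hW.swap_right a b 0 2
  have r30 := fun a b => hW.swap_right a b 0 3
  have r21 := fun a b => hW.swap_right a b 1 2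
  have r31 := fun a b => hW.swap_right a b 1 3
  have r32 := fun a b => hW.swap_right a b 2 3
  have r10' := fun a b => hWd.swap_right a b 0 1
  have r20' := fun a b => hWd.swap_right a b 0 2
  have r30' := fun a b => hWd.swap_right a b 0 3
  have r21' := fun a b => hWd.swap_right a b 1 2
  have r31' := fun a b => hWd.swap_right a b 1 3
  have r32' := fun a b => hWd.swap_right a b 2 3
  have d01 := fun a b => (wdual_apply hW a b).1
  have d02 := fun a b => (wdual_apply hW a b).2.1
  have d03 := fun a b => (wdual_apply hW a b).2.2.1
  have d12 := fun a b => (wdual_apply hW a b).2.2.2.1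
  have d13 := fun a b => (wdual_apply hW a b).2.2.2.2.1
  have d23 := fun a b => (wdual_apply hW a b).2.2.2.2.2
  have p01 := hpair 0 1
  have p02 := hpair 0 2
  have p03 := hpair 0 3
  have p12 := hpair 1 2 1 3
  have p12' := hpair 1 2 2 3
  have p13 := hpair 1 3 2 3
  have ric : ∀ b d, W 0 b 0 d = W 1 b 1 d + W 2 b 2 d + W 3 b 3 d := by
    intro b d
    have h := htrace b d
    simp [Fin.sum_univ_four, eta] at h
    linarith
  have t00 := ric 0 0
  have t01 := ric 0 1
  have t02 := ric 0 2
  have t03 := ric 0 3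
  have t11 := ric 1 1
  have t12 := ric 1 2
  have t13 := ric 1 3
  have t22 := ric 2 2
  have t23 := ric 2 3
  have t33 := ric 3 3
  have b0123 := hbianchi 0 1 2 3
  simp only [hl, hr, l10, l20, l30, l21, l31, l32, r10, r20, r30, r21, r31, r32, neg_neg]
    at t00 t01 t02 t03 t11 t12 t13 t22 t23 t33 b0123
  -- Ten components are independent; the remaining ordered ones are expressed through them.
  have q0123 : W 0 1 2 3 = W 0 2 1 3 - W 0 3 1 2 := by linarith
  have q0303 : W 0 3 0 3 = -W 0 1 0 1 - W 0 2 0 2 := by linarith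
  have q0313 : W 0 3 1 3 = -W 0 2 1 2 := by linarith
  have q0323 : W 0 3 2 3 = W 0 1 1 2 := by linarith
  have q0223 : W 0 2 2 3 = -W 0 1 1 3 := by linarith
  have q1323 : W 1 3 2 3 = W 0 1 0 2 := by linarith
  have q1223 : W 1 2 2 3 = -W 0 1 0 3 := by linarith
  have q1213 : W 1 2 1 3 = W 0 2 0 3 := by linarith
  have q1212 : W 1 2 1 2 = W 0 1 0 1 + W 0 2 0 2 := by linarith
  have q1313 : W 1 3 1 3 = -W 0 2 0 2 := by linarith
  have q2323 : W 2 3 2 3 = -W 0 1 0 1 := by linarith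
  obtain ⟨e01, e02, e03, e12, e13, e23⟩ := eps3U1_apply u
  simp only [magnetic, electric_apply hW, electric_apply hWd, Fin.sum_univ_four]
  refine forall_lt_fin_four ?_ ?_ ?_ ?_ ?_ ?_ <;>
    refine forall_lt_fin_four ?_ ?_ ?_ ?_ ?_ ?_
  all_goals
    simp [eta, hl, hr, hr', l10, l20, l30, l21, l31, l32,
      r10, r20, r30, r21, r31, r32, r10', r20', r30', r21', r31', r32',
      d01, d02, d03, d12, d13, d23, e01, e02, e03, e12, e13, e23,
      p01 0 2, p01 0 3, p01 1 2, p01 1 3, p01 2 3, p02 0 3, p02 1 2, p02 1 3, p02 2 3,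
      p03 1 2, p03 1 3, p03 2 3, p12, p12', p13,
      q0123, q0303, q0313, q0323, q0223, q1323, q1223, q1213, q1212, q1313, q2323]
    ring

/-- **Reconstruction of a Weyl-type tensor from its electric and magnetic parts:**
`W_{αβγδ} = 2(π_{β[γ}E_{δ]α} − u_β u_{[γ}E_{δ]α} − π_{α[γ}E_{δ]β} + u_α u_{[γ}E_{δ]β})`
`− 2(u_{[γ}B_{δ]μ}ε^μ{}_{αβ} + u_{[α}B_{β]μ}ε^μ{}_{γδ})`
(antisymmetrization with weight 1/2). -/
theorem weyl_reconstruction_from_electric_magnetic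
    (W : Fin 4 → Fin 4 → Fin 4 → Fin 4 → ℝ) (u : Fin 4 → ℝ)
    -- u unit timelike
    (hu : ∑ α, ∑ β, eta α β * u α * u β = 1)
    -- Weyl symmetries of W
    (hA1 : ∀ a b c d, W b a c d = -W a b c d)
    (hA2 : ∀ a b c d, W a b d c = -W a b c d)
    (hpair : ∀ a b c d, W c d a b = W a b c d)
    (hbianchi : ∀ a b c d, W a b c d + W a c d b + W a d b c = 0)
    (htrace : ∀ b d, (∑ a, ∑ c, eta a c * W a b c d) = 0) :
    ∀ a b c d,
      W a b c d =
        2 * ((1/2) * (projLL u b c * electric W u d a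
                - projLL u b d * electric W u c a)
          - u b * ((1/2) * (u c * electric W u d a - u d * electric W u c a))
          - (1/2) * (projLL u a c * electric W u d b
                - projLL u a d * electric W u c b)
          + u a * ((1/2) * (u c * electric W u d b - u d * electric W u c b)))
        - 2 * ((1/2) * (u c * (∑ m, magnetic W u d m * eps3U1 u m a b)
                - u d * (∑ m, magnetic W u c m * eps3U1 u m a b))
            + (1/2) * (u a * (∑ m, magnetic W u b m * eps3U1 u m c d)
                - u b * (∑ m, magnetic W u a m * eps3U1 u m c d))) := by
  intro a b c d
  have hW : IsBiantisymmetric W := ⟨hA1, hA2⟩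
  have key := weyl_reconstruction_homogeneous hW hpair hbianchi htrace u a b c d
  rw [hu] at key
  simp only [projLL]
  linear_combination key
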